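/- arXiv:1412.8005 — 9 statements merged into one kernel-verified Lean document; each statement's English description precedes it below -/
import Mathlib

section
/- Let I be a finite nonempty set of intervals with pairwise distinct finishing times, and let J be the greedy optimal set of I. Then J is a compatible set of I, and for every compatible set K of I, |K| ≤ |J|; that is, the greedy optimal set is an optimal (maximum-size) compatible set. -/
/-- Two intervals (given as pairs (start, finish)) are compatible if one
finishes strictly before the other starts. -/
def Compatible (i j : ℝ × ℝ) : Prop := i.2 < j.1 ∨ j.2 < i.1

/-- `j` is the right compatible interval of `i` in `I`: the ≼-least element of
`I` compatible with `i` and strictly after `i` in the ordering by finishing time. -/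
def IsRC (I : Finset (ℝ × ℝ)) (i j : ℝ × ℝ) : Prop :=
  j ∈ I ∧ i.2 < j.2 ∧ Compatible i j ∧
    ∀ k ∈ I, i.2 < k.2 → Compatible i k → j.2 ≤ k.2

/-- `m` is the ≼-least interval of `I` (ordering by finishing time). -/
def IsLeastInterval (I : Finset (ℝ × ℝ)) (m : ℝ × ℝ) : Prop :=
  m ∈ I ∧ ∀ j ∈ I, m.2 ≤ j.2

/-- Membership in the greedy optimal set of `I`: the ≼-least interval is in it,
and it is closed under taking right compatible intervals. -/
inductive InGreedy (I : Finset (ℝ × ℝ)) : ℝ × ℝ → Prop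
  | base (m : ℝ × ℝ) : IsLeastInterval I m → InGreedy I m
  | step (i j : ℝ × ℝ) : InGreedy I i → IsRC I i j → InGreedy I j

theorem InGreedy.mem {I : Finset (ℝ × ℝ)} {i : ℝ × ℝ} (h : InGreedy I i) : i ∈ I := by
  cases h with
  | base _ h => exact h.1
  | step _ _ _ h => exact h.1

theorem Compatible.finish_lt_start {i j : ℝ × ℝ} (h : Compatible i j) (hi : i.1 < i.2)
    (hij : i.2 < j.2) : i.2 < j.1 :=
  h.resolve_right fun h' => by linarith

/-- An interval with a compatible later interval has a right compatible interval. -/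
theorem exists_isRC {I : Finset (ℝ × ℝ)} {i k : ℝ × ℝ} (hk : k ∈ I) (hik : i.2 < k.2)
    (hc : Compatible i k) : ∃ j, IsRC I i j ∧ j.2 ≤ k.2 := by
  classical
  obtain ⟨j, hj, hmin⟩ := (I.filter fun x => i.2 < x.2 ∧ Compatible i x).exists_min_image
    Prod.snd ⟨k, by simp only [Finset.mem_filter]; exact ⟨hk, hik, hc⟩⟩
  simp only [Finset.mem_filter] at hj hmin
  exact ⟨j, ⟨hj.1, hj.2.1, hj.2.2, fun x hx h h' => hmin x ⟨hx, h, h'⟩⟩, hmin k ⟨hk, hik, hc⟩⟩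

/-- A greedy interval finishing before another one finishes before the other one starts. -/
theorem InGreedy.finish_lt_start {I : Finset (ℝ × ℝ)} (hval : ∀ i ∈ I, i.1 < i.2)
    (hdist : ∀ i ∈ I, ∀ j ∈ I, i.2 = j.2 → i = j) {i j : ℝ × ℝ} (hi : InGreedy I i)
    (hj : InGreedy I j) (hij : i.2 < j.2) : i.2 < j.1 := by
  induction hj generalizing i with
  | base m hm => exact absurd (hm.2 i hi.mem) hij.not_ge
  | step p j hp hpj ih =>
    have hpj_lt : p.2 < j.1 := hpj.2.2.1.finish_lt_start (hval p hp.mem) hpj.2.1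
    suffices h : i.2 ≤ p.2 from h.trans_lt hpj_lt
    induction hi with
    | base m hm => exact hm.2 p hp.mem
    | step q i hq hqi ih_pred =>
      rcases (ih_pred (hqi.2.1.trans hij)).eq_or_lt with h | h
      · obtain rfl := hdist q hq.mem p hp.mem h
        exact absurd (hpj.2.2.2 i hqi.1 hqi.2.1 hqi.2.2.1) hij.not_ge
      · exact hqi.2.2.2 p hp.mem h (Or.inl (ih hq h))

/-- Every interval of `I` has a last greedy interval finishing no later than it. -/
theorem exists_last_inGreedy {I : Finset (ℝ × ℝ)} {k : ℝ × ℝ} (hk : k ∈ I) :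
    ∃ g, InGreedy I g ∧ g.2 ≤ k.2 ∧ ∀ x, InGreedy I x → x.2 ≤ k.2 → x.2 ≤ g.2 := by
  classical
  obtain ⟨m, hm, hmin⟩ := I.exists_min_image Prod.snd ⟨k, hk⟩
  obtain ⟨g, hg, hmax⟩ := (I.filter fun x => InGreedy I x ∧ x.2 ≤ k.2).exists_max_image
    Prod.snd ⟨m, by
      simp only [Finset.mem_filter]
      exact ⟨hm, .base m ⟨hm, hmin⟩, hmin k hk⟩⟩
  simp only [Finset.mem_filter] at hg hmax
  exact ⟨g, hg.2.1, hg.2.2, fun x hx h => hmax x ⟨hx.mem, hx, h⟩⟩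

/-- The greedy optimal set `J = {i | InGreedy I i}` is a compatible set of `I`
of maximum cardinality among compatible sets of `I`. -/
theorem greedy_set_is_optimal (I : Finset (ℝ × ℝ)) (hne : I.Nonempty)
    (hval : ∀ i ∈ I, i.1 < i.2)
    (hdist : ∀ i ∈ I, ∀ j ∈ I, i.2 = j.2 → i = j) :
    (∀ i, InGreedy I i → i ∈ I) ∧
    (∀ i j, InGreedy I i → InGreedy I j → i ≠ j → Compatible i j) ∧
    (∀ K : Finset (ℝ × ℝ), K ⊆ I →
      (∀ i ∈ K, ∀ j ∈ K, i ≠ j → Compatible i j) →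
      K.card ≤ {i | InGreedy I i}.ncard) := by
  refine ⟨fun i hi => hi.mem, fun i j hi hj hne => ?_, fun K hKI hK => ?_⟩
  · rcases lt_trichotomy i.2 j.2 with h | h | h
    · exact Or.inl (hi.finish_lt_start hval hdist hj h)
    · exact absurd (hdist i hi.mem j hj.mem h) hne
    · exact Or.inr (hj.finish_lt_start hval hdist hi h)
  · choose! g hg hgle hgmax using fun k (hk : k ∈ I) => exists_last_inGreedy hk
    have g_ne : ∀ a ∈ K, ∀ b ∈ K, a.2 < b.2 → g a ≠ g b := by
      intro a ha b hb hab heq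
      have hab' : a.2 < b.1 := (hK a ha b hb fun h => hab.ne (congrArg Prod.snd h)).finish_lt_start
        (hval a (hKI ha)) hab
      have hga := hgle a (hKI ha)
      obtain ⟨r, hr, hrb⟩ := exists_isRC (hKI hb) (hga.trans_lt hab) (Or.inl (hga.trans_lt hab'))
      have hrg := hgmax b (hKI hb) r (.step _ r (hg a (hKI ha)) hr) hrb
      exact absurd (heq ▸ hrg) hr.2.1.not_ge
    have hfin : {i | InGreedy I i}.Finite := I.finite_toSet.subset fun i hi => InGreedy.mem hi
    rw [← Set.ncard_coe_finset]
    refine Set.ncard_le_ncard_of_injOn g (fun k hk => hg k (hKI hk)) (fun a ha b hb heq => ?_) hfin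
    rcases lt_trichotomy a.2 b.2 with h | h | h
    · exact absurd heq (g_ne a ha b hb h)
    · exact hdist a (hKI ha) b (hKI hb) h
    · exact absurd heq.symm (g_ne b hb a ha h)
end

section
/- Let I be a finite monotonic set of intervals with pairwise distinct finishing times, and let i, j, ℓ ∈ I with i ≺ ℓ ≺ j. If i overlaps j, then ℓ overlaps i and ℓ overlaps j; that is, in a monotonic set, every interval lying between two overlapping intervals overlaps both of them. -/
/-- A set of intervals is monotonic if no interval properly contains another. -/
def Monotonic (I : Finset (ℝ × ℝ)) : Prop :=
  ∀ i ∈ I, ∀ j ∈ I, i ≠ j → ¬(i.1 ≤ j.1 ∧ j.2 ≤ i.2)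

/-- In a monotonic set, every interval lying (in the order by finishing time)
between two overlapping intervals overlaps both of them. -/
theorem between_overlapping_overlaps (I : Finset (ℝ × ℝ))
    (hval : ∀ i ∈ I, i.1 < i.2)
    (hdist : ∀ i ∈ I, ∀ j ∈ I, i.2 = j.2 → i = j)
    (hmono : Monotonic I)
    (i j l : ℝ × ℝ) (hi : i ∈ I) (hj : j ∈ I) (hl : l ∈ I)
    (h1 : i.2 < l.2) (h2 : l.2 < j.2)
    (hov : ¬ Compatible i j) :
    ¬ Compatible l i ∧ ¬ Compatible l j := by
  have hji : j.1 ≤ i.2 := not_lt.mp fun h => hov (Or.inl h)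
  have hlj : l.1 < j.1 := by
    by_contra! h
    exact hmono j hj l hl (fun e => h2.ne (congrArg Prod.snd e.symm)) ⟨h, h2.le⟩
  have hi_lt := hval i hi
  have hj_lt := hval j hj
  constructor <;> rintro (h | h) <;> linarith
end

section
/- Let I be a finite monotonic set of intervals with pairwise distinct finishing times and let i ∈ I. Then the set {j ∈ I : i ≺ j and j is compatible with i} is upward closed with respect to ≼: if i ≺ j, j is compatible with i, and j ≼ k for k ∈ I, then k is compatible with i. Consequently rc(i), when it exists, is the unique ≼-least element of this upward-closed set. -/
/-- In a monotonic set, for each interval `i` the set of intervals after `i`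
compatible with `i` is upward closed in the order by finishing time; hence the
right compatible interval of `i`, when it exists, is its unique ≼-least element. -/
theorem compatible_after_upward_closed (I : Finset (ℝ × ℝ))
    (hval : ∀ i ∈ I, i.1 < i.2)
    (hdist : ∀ i ∈ I, ∀ j ∈ I, i.2 = j.2 → i = j)
    (hmono : Monotonic I)
    (i : ℝ × ℝ) (hi : i ∈ I) :
    (∀ j ∈ I, ∀ k ∈ I, i.2 < j.2 → Compatible i j → j.2 ≤ k.2 → Compatible i k) ∧
    (∀ r r' : ℝ × ℝ, IsRC I i r → IsRC I i r' → r = r') := by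
  refine ⟨fun j hj k hk hij hc hjk => ?_, fun r r' hr hr' => ?_⟩
  · have hij' : i.2 < j.1 := hc.resolve_right fun h => by linarith [hval i hi]
    rcases eq_or_ne k j with rfl | hne
    · exact hc
    · have hstart : j.1 < k.1 := lt_of_not_ge fun h => hmono k hk j hj hne ⟨h, hjk⟩
      exact Or.inl (hij'.trans hstart)
  · obtain ⟨hr, hir, hcr, hmin⟩ := hr
    obtain ⟨hr', hir', hcr', hmin'⟩ := hr'
    exact hdist r hr r' hr' (le_antisymm (hmin r' hr' hir' hcr') (hmin' r hr hir hcr))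
end

section
/- Let I be a finite set of intervals with pairwise distinct finishing times and let i, j ∈ I with i ≼ j. If rc(j) exists, then rc(i) exists and rc(i) ≼ rc(j); that is, the right compatible interval map rc is monotone with respect to ≼, and its domain is downward closed in ≼. -/
/-- The right compatible interval map is monotone with respect to the ordering
by finishing time, and its domain is downward closed: if `i ≼ j` and `rc(j)`
exists, then `rc(i)` exists and `rc(i) ≼ rc(j)`. -/
theorem rc_monotone (I : Finset (ℝ × ℝ))
    (hval : ∀ i ∈ I, i.1 < i.2)
    (hdist : ∀ i ∈ I, ∀ j ∈ I, i.2 = j.2 → i = j)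
    (i j : ℝ × ℝ) (hi : i ∈ I) (hj : j ∈ I) (hij : i.2 ≤ j.2)
    (r : ℝ × ℝ) (hr : IsRC I j r) :
    ∃ r' : ℝ × ℝ, IsRC I i r' ∧ r'.2 ≤ r.2 := by
  classical
  obtain ⟨hrI, hjr, hc, -⟩ := hr
  have hjr1 : j.2 < r.1 := hc.resolve_right fun h => by linarith [hval j hj]
  have hmem : r ∈ I.filter fun k => i.2 < k.2 ∧ Compatible i k :=
    Finset.mem_filter.2 ⟨hrI, hij.trans_lt hjr, Or.inl (hij.trans_lt hjr1)⟩
  obtain ⟨m, hm, hmin⟩ := Finset.exists_min_image _ Prod.snd ⟨r, hmem⟩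
  obtain ⟨hmI, him, hcm⟩ := Finset.mem_filter.1 hm
  exact ⟨m, ⟨hmI, him, hcm, fun k hk hik hck =>
    hmin k (Finset.mem_filter.2 ⟨hk, hik, hck⟩)⟩, hmin r hmem⟩
end

section
/- Let I be a finite set of intervals with pairwise distinct finishing times and let i, j, k ∈ I with i ≺ k ≺ j. If rc(i) and rc(j) both exist and rc(i) = rc(j), then rc(k) exists and rc(k) = rc(i); that is, each equivalence class of the relation i ∼ j ⇔ rc(i) = rc(j) is a contiguous block of the order ≼. -/
/-- Each equivalence class of the relation `rc(i) = rc(j)` is a contiguous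
block of the ordering by finishing time: if `i ≺ k ≺ j` and `rc(i) = rc(j) = r`,
then `rc(k)` exists and equals `r`. -/
theorem rc_class_contiguous (I : Finset (ℝ × ℝ))
    (hval : ∀ i ∈ I, i.1 < i.2)
    (hdist : ∀ i ∈ I, ∀ j ∈ I, i.2 = j.2 → i = j)
    (i j k : ℝ × ℝ) (hi : i ∈ I) (hj : j ∈ I) (hk : k ∈ I)
    (h1 : i.2 < k.2) (h2 : k.2 < j.2)
    (r : ℝ × ℝ) (hri : IsRC I i r) (hrj : IsRC I j r) :
    IsRC I k r := by
  obtain ⟨hr, hjr, hcomp, -⟩ := hrj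
  have hjr' : j.2 < r.1 := hcomp.resolve_right fun h => by linarith [hval j hj]
  refine ⟨hr, h2.trans hjr, Or.inl (h2.trans hjr'), fun m hm hkm hc => ?_⟩
  have hkm' : k.2 < m.1 := hc.resolve_right fun h => by linarith [hval k hk]
  exact hri.2.2.2 m hm (h1.trans hkm) (Or.inl (h1.trans hkm'))
end

section
/- Let I be a finite set of intervals with pairwise distinct finishing times and let i ∈ I be such that rc(i) exists. Then i is the ≼-greatest interval in its equivalence class [i] if and only if lc(rc(i)) = i. -/
/-- `j` is the left compatible interval of `i` in `I`: the ≼-greatest element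
of `I` compatible with `i` and strictly before `i` in the ordering by finishing
time. -/
def IsLC (I : Finset (ℝ × ℝ)) (i j : ℝ × ℝ) : Prop :=
  j ∈ I ∧ j.2 < i.2 ∧ Compatible i j ∧
    ∀ k ∈ I, k.2 < i.2 → Compatible i k → k.2 ≤ j.2

/-- An interval `i` (with `r = rc(i)`) is the ≼-greatest interval in its
equivalence class `[i] = {j | rc(j) = rc(i)}` if and only if `lc(rc(i)) = i`. -/
theorem greatest_in_class_iff_lc_rc (I : Finset (ℝ × ℝ))
    (hval : ∀ i ∈ I, i.1 < i.2)
    (hdist : ∀ i ∈ I, ∀ j ∈ I, i.2 = j.2 → i = j)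
    (i : ℝ × ℝ) (hi : i ∈ I) (r : ℝ × ℝ) (hr : IsRC I i r) :
    (∀ j ∈ I, IsRC I j r → j.2 ≤ i.2) ↔ IsLC I r i := by
  obtain ⟨hrI, hir, hcomp, hleast⟩ := hr
  constructor
  · refine fun hmax => ⟨hi, hir, hcomp.symm, fun k hk hkr hrk => ?_⟩
    by_contra! hik
    refine hik.not_ge (hmax k hk ⟨hrI, hkr, hrk.symm, fun m hm hkm hc => ?_⟩)
    refine hleast m hm (hik.trans hkm) (hc.imp hik.trans fun hmk => ?_)
    exact absurd (hmk.trans (hval k hk)) hkm.not_gt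
  · rintro ⟨-, -, -, hgreatest⟩ j hj ⟨-, hjr, hc, -⟩
    exact hgreatest j hj hjr hc.symm
end

section
/- For every finite rooted forest F = (V, p) there exists a finite monotonic set I of intervals with pairwise distinct finishing times and a bijection φ : V → I such that for all v, u ∈ V: u is the parent of v in F if and only if rc(φ(v)) exists and rc(φ(v)) = φ(u); in particular v is a root of F if and only if rc(φ(v)) does not exist. That is, every finite forest is (up to isomorphism) the compatibility forest of some monotonic set of intervals. -/
/-- Nodes of a well-founded forest can be numbered by reading the labels `e + 1` along the path
from the root as digits in base `B`. -/
theorem exists_path_numeral {V : Type*} (p : V → Option V)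
    (hwf : WellFounded fun a b : V => p b = some a) (B : ℕ) (e : V → ℕ) :
    ∃ k : V → ℕ, (∀ v, p v = none → k v = e v + 1) ∧
      ∀ v u, p v = some u → k v = B * k u + (e v + 1) := by
  let step (v : V) (rec : ∀ u, p v = some u → ℕ) : ℕ :=
    match h : p v with
    | none => e v + 1
    | some u => B * rec u h + (e v + 1)
  refine ⟨hwf.fix step, fun v hv => ?_, fun v u hv => ?_⟩
  · rw [hwf.fix_eq]
    simp only [step]
    split <;> simp_all
  · rw [hwf.fix_eq]
    simp only [step]
    split
    · simp_all
    · next w hw =>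
      obtain rfl : w = u := Option.some.inj (hw.symm.trans hv)
      rfl

/-- The interval `[-B * m, -m]`. -/
def scaledInterval (B m : ℕ) : ℝ × ℝ := (-((B * m : ℕ) : ℝ), -(m : ℝ))

theorem scaledInterval_injective (B : ℕ) : Function.Injective (scaledInterval B) := by
  intro a b h
  simpa [scaledInterval] using congrArg Prod.snd h

theorem lt_and_compatible_scaledInterval_iff {B a b : ℕ} (hB : 1 ≤ B) :
    ((scaledInterval B a).2 < (scaledInterval B b).2 ∧
      Compatible (scaledInterval B a) (scaledInterval B b)) ↔ B * b < a := by
  simp only [scaledInterval, Compatible, neg_lt_neg_iff, Nat.cast_lt]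
  constructor
  · rintro ⟨h, h' | h'⟩
    · exact h'
    · nlinarith
  · intro h
    exact ⟨by nlinarith, Or.inl h⟩

theorem isRC_scaledInterval_iff {V : Type*} {B : ℕ} (hB : 1 ≤ B) {k : V → ℕ}
    {I : Finset (ℝ × ℝ)} (hI : ∀ i, i ∈ I ↔ ∃ v, scaledInterval B (k v) = i) (v u : V) :
    IsRC I (scaledInterval B (k v)) (scaledInterval B (k u)) ↔
      B * k u < k v ∧ ∀ w, B * k w < k v → k w ≤ k u := by
  have key (w : V) := lt_and_compatible_scaledInterval_iff (a := k v) (b := k w) hB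
  have hle (w : V) : (scaledInterval B (k u)).2 ≤ (scaledInterval B (k w)).2 ↔ k w ≤ k u := by
    simp [scaledInterval]
  constructor
  · rintro ⟨-, hlt, hc, hmin⟩
    refine ⟨(key u).1 ⟨hlt, hc⟩, fun w hw => ?_⟩
    obtain ⟨h, h'⟩ := (key w).2 hw
    exact (hle w).1 (hmin _ ((hI _).2 ⟨w, rfl⟩) h h')
  · rintro ⟨h, hmin⟩
    refine ⟨(hI _).2 ⟨u, rfl⟩, ((key u).2 h).1, ((key u).2 h).2, fun i hi hlt hc => ?_⟩
    obtain ⟨w, rfl⟩ := (hI i).1 hi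
    exact (hle w).2 (hmin w ((key w).1 ⟨hlt, hc⟩))

/-- Every finite rooted forest (nodes `V`, parent assignment `p`, acyclic) is,
up to isomorphism, the compatibility forest of some finite monotonic set of
intervals with pairwise distinct finishing times. -/
theorem forest_realizable_as_compatibility_forest
    {V : Type*} [Finite V] (p : V → Option V)
    (hwf : WellFounded fun a b : V => p b = some a) :
    ∃ (I : Finset (ℝ × ℝ)) (φ : V → ℝ × ℝ),
      (∀ i ∈ I, i.1 < i.2) ∧
      (∀ i ∈ I, ∀ j ∈ I, i.2 = j.2 → i = j) ∧
      Monotonic I ∧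
      Function.Injective φ ∧
      (∀ v : V, φ v ∈ I) ∧
      (∀ i ∈ I, ∃ v : V, φ v = i) ∧
      (∀ v u : V, p v = some u ↔ IsRC I (φ v) (φ u)) ∧
      (∀ v : V, p v = none ↔ ¬ ∃ r : ℝ × ℝ, IsRC I (φ v) r) := by
  obtain ⟨n, ⟨e⟩⟩ := Finite.exists_equiv_fin V
  have he (v : V) : (e v : ℕ) < n := (e v).isLt
  obtain ⟨k, hroot, hchild⟩ := exists_path_numeral p hwf (n + 2) fun v => (e v : ℕ)
  have hmod (v : V) : k v % (n + 2) = e v + 1 := by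
    have hlt : (e v : ℕ) + 1 < n + 2 := by have := he v; omega
    cases hv : p v with
    | none => rw [hroot v hv, Nat.mod_eq_of_lt hlt]
    | some u => rw [hchild v u hv, Nat.mul_add_mod, Nat.mod_eq_of_lt hlt]
  have hpos (v : V) : 0 < k v := by
    by_contra h
    have := hmod v
    simp_all
  have hk : Function.Injective k := fun v w h => by
    apply e.injective
    apply Fin.ext
    have := hmod v
    rw [h, hmod w] at this
    omega
  have hI (i : ℝ × ℝ) : i ∈ (Set.finite_range fun v => scaledInterval (n + 2) (k v)).toFinset ↔
      ∃ v, scaledInterval (n + 2) (k v) = i := by simp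
  have hrc := isRC_scaledInterval_iff (by omega) hI
  have hinj := (scaledInterval_injective (n + 2)).comp hk
  have hparent (v u : V) (hv : p v = some u) :
      (n + 2) * k u < k v ∧ ∀ w, (n + 2) * k w < k v → k w ≤ k u := by
    have := he v
    rw [hchild v u hv]
    refine ⟨by omega, fun w hw => ?_⟩
    by_contra! h
    nlinarith
  have hiff (v u : V) : p v = some u ↔
      (n + 2) * k u < k v ∧ ∀ w, (n + 2) * k w < k v → k w ≤ k u := by
    refine ⟨hparent v u, fun ⟨hlt, hmin⟩ => ?_⟩
    cases hv : p v with
    | none =>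
      have := he v
      have := hpos u
      rw [hroot v hv] at hlt
      nlinarith
    | some w =>
      obtain ⟨hlt', hmin'⟩ := hparent v w hv
      rw [hk (le_antisymm (hmin w hlt') (hmin' u hlt))]
  refine ⟨_, fun v => scaledInterval (n + 2) (k v), ?_, ?_, ?_, hinj,
    fun v => (hI _).2 ⟨v, rfl⟩, fun i => (hI i).1, fun v u => (hiff v u).trans (hrc v u).symm, ?_⟩
  · intro i hi
    obtain ⟨v, rfl⟩ := (hI i).1 hi
    have := hpos v
    simp only [scaledInterval, neg_lt_neg_iff, Nat.cast_lt]
    nlinarith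
  · intro i hi j hj h
    obtain ⟨v, rfl⟩ := (hI i).1 hi
    obtain ⟨w, rfl⟩ := (hI j).1 hj
    have : k v = k w := by simpa [scaledInterval] using h
    rw [this]
  · intro i hi j hj hne h
    obtain ⟨v, rfl⟩ := (hI i).1 hi
    obtain ⟨w, rfl⟩ := (hI j).1 hj
    simp only [scaledInterval, neg_le_neg_iff, Nat.cast_le] at h
    exact hne (congrArg _ (le_antisymm h.2 (Nat.le_of_mul_le_mul_left h.1 (by omega))))
  · intro v
    constructor
    · rintro hv ⟨r, hr⟩
      obtain ⟨u, rfl⟩ := (hI r).1 hr.1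
      simp [(hiff v u).2 ((hrc v u).1 hr)] at hv
    · intro h
      cases hv : p v with
      | none => rfl
      | some u => exact absurd ⟨_, (hrc v u).2 (hparent v u hv)⟩ h
end

section
/- Let I be a finite monotonic set of intervals with pairwise distinct finishing times, let i be an interval not in I such that I' = I ∪ {i} is again monotonic with pairwise distinct finishing times, and let L(I) = (I; E) and L(I') = (I'; E') be the corresponding linearised trees (E and E' denoting the unions of the two edge sets). Then for all j, k ∈ I: if (j,k) ∈ E and (j,k) ∉ E', then (j,i) ∈ E'; that is, any edge destroyed by inserting i is replaced by an edge from its tail to i. -/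
/-- Equivalence edge of the linearised tree: `i ∼ j` (same right compatible
interval) and `i` is the ≼-predecessor of `j` in `I`. -/
def ESim (I : Finset (ℝ × ℝ)) (i j : ℝ × ℝ) : Prop :=
  i ∈ I ∧ j ∈ I ∧ (∃ r, IsRC I i r ∧ IsRC I j r) ∧
    i.2 < j.2 ∧ ∀ k ∈ I, i.2 < k.2 → j.2 ≤ k.2

/-- Compatibility edge of the linearised tree: `rc(i)` exists, `i` is the
≼-greatest element of its equivalence class `[i]`, and `j = rc(i)`. -/
def EC (I : Finset (ℝ × ℝ)) (i j : ℝ × ℝ) : Prop :=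
  i ∈ I ∧ IsRC I i j ∧ ∀ k ∈ I, IsRC I k j → k.2 ≤ i.2

/-- An edge of the linearised tree `L(I)` (union of the two edge sets). -/
def LTEdge (I : Finset (ℝ × ℝ)) (i j : ℝ × ℝ) : Prop :=
  ESim I i j ∨ EC I i j

/-- For genuine intervals, the right compatible interval of `x` is the one finishing first among
those starting after `x` finishes. -/
theorem isRC_iff {I : Finset (ℝ × ℝ)} {x r : ℝ × ℝ} (hI : ∀ y ∈ I, y.1 < y.2) (hx : x.1 < x.2) :
    IsRC I x r ↔ r ∈ I ∧ x.2 < r.1 ∧ ∀ y ∈ I, x.2 < y.1 → r.2 ≤ y.2 := by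
  constructor
  · rintro ⟨hr, hlt, hc, hmin⟩
    refine ⟨hr, hc.resolve_right fun h => by linarith, fun y hy hxy => ?_⟩
    exact hmin y hy (hxy.trans (hI y hy)) (Or.inl hxy)
  · rintro ⟨hr, hlt, hmin⟩
    refine ⟨hr, hlt.trans (hI r hr), Or.inl hlt, fun y hy hxy hc => ?_⟩
    exact hmin y hy (hc.resolve_right fun h => by linarith)

/-- In a monotonic set the starting times are ordered as the finishing times. -/
theorem Monotonic.start_lt_start {I : Finset (ℝ × ℝ)} (hI : Monotonic I) {x y : ℝ × ℝ}
    (hx : x ∈ I) (hy : y ∈ I) (h : x.2 < y.2) : x.1 < y.1 := by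
  by_contra hle
  exact hI y hy x hx (fun e => by simp [e] at h) ⟨not_lt.mp hle, h.le⟩

/-- Right compatible intervals are inherited by later intervals finishing before `r` starts. -/
theorem IsRC.of_le {I : Finset (ℝ × ℝ)} {x m r : ℝ × ℝ} (hI : ∀ y ∈ I, y.1 < y.2)
    (hx : x.1 < x.2) (hm : m.1 < m.2) (h : IsRC I x r) (hxm : x.2 ≤ m.2) (hmr : m.2 < r.1) :
    IsRC I m r := by
  rw [isRC_iff hI hx] at h
  rw [isRC_iff hI hm]
  exact ⟨h.1, hmr, fun y hy hmy => h.2.2 y hy (hxm.trans_lt hmy)⟩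

theorem IsRC.insert_of_imp_le {I : Finset (ℝ × ℝ)} {i x r : ℝ × ℝ} (h : IsRC I x r)
    (hi : x.2 < i.2 → Compatible x i → r.2 ≤ i.2) : IsRC (insert i I) x r := by
  refine ⟨Finset.mem_insert_of_mem h.1, h.2.1, h.2.2.1, ?_⟩
  rw [Finset.forall_mem_insert]
  exact ⟨hi, h.2.2.2⟩

theorem IsRC.insert_self {I : Finset (ℝ × ℝ)} {i x r : ℝ × ℝ} (h : IsRC I x r)
    (hxi : x.2 < i.2) (hc : Compatible x i) (hir : i.2 ≤ r.2) : IsRC (insert i I) x i := by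
  refine ⟨Finset.mem_insert_self i I, hxi, hc, ?_⟩
  rw [Finset.forall_mem_insert]
  exact ⟨fun _ _ => le_rfl, fun y hy hxy hcy => hir.trans (h.2.2.2 y hy hxy hcy)⟩

theorem IsRC.of_insert {I : Finset (ℝ × ℝ)} {i x r : ℝ × ℝ} (h : IsRC (insert i I) x r)
    (hr : r ∈ I) : IsRC I x r :=
  ⟨hr, h.2.1, h.2.2.1, fun y hy => h.2.2.2 y (Finset.mem_insert_of_mem hy)⟩

theorem IsRC.finish_lt_start {I : Finset (ℝ × ℝ)} {x r : ℝ × ℝ} (hI : ∀ y ∈ I, y.1 < y.2)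
    (hx : x.1 < x.2) (h : IsRC I x r) : x.2 < r.1 :=
  ((isRC_iff hI hx).mp h).2.1

theorem ESim.lTEdge_insert {I : Finset (ℝ × ℝ)} {i j k : ℝ × ℝ}
    (hval : ∀ x ∈ insert i I, x.1 < x.2) (hmono : Monotonic (insert i I))
    (h : ESim I j k) (hn : ¬ LTEdge (insert i I) j k) : LTEdge (insert i I) j i := by
  obtain ⟨hj, hk, ⟨r, hjr, hkr⟩, hjk, hpred⟩ := h
  have hI : ∀ x ∈ I, x.1 < x.2 := fun x hx => hval x (Finset.mem_insert_of_mem hx)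
  have hi := hval i (Finset.mem_insert_self i I)
  have hkr1 := hkr.finish_lt_start hI (hI k hk)
  have hr := hI r hjr.1
  have hjv := hI j hj
  have hkv := hI k hk
  have hj' := Finset.mem_insert_of_mem (b := i) hj
  have hk' := Finset.mem_insert_of_mem (b := i) hk
  have hi' := Finset.mem_insert_self i I
  by_cases hb : j.2 < i.2 ∧ i.2 < k.2
  · have hik := hmono.start_lt_start hi' hk' hb.2
    have hji : ¬ Compatible j i := by
      rintro (hc | hc)
      · have := hjr.2.2.2 k hk hjk (Or.inl (hc.trans hik))
        linarith
      · linarith [hb.1]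
    have hjr' : IsRC (insert i I) j r := hjr.insert_of_imp_le fun _ hc => absurd hc hji
    refine Or.inl ⟨hj', hi', ⟨r, hjr', ?_⟩, hb.1, ?_⟩
    · exact hjr'.of_le hval hjv hi hb.1.le (hb.2.trans hkr1)
    · rw [Finset.forall_mem_insert]
      exact ⟨fun _ => le_rfl, fun y hy hjy => hb.2.le.trans (hpred y hy hjy)⟩
  · have hpred' : ∀ y ∈ insert i I, j.2 < y.2 → k.2 ≤ y.2 := by
      rw [Finset.forall_mem_insert]
      exact ⟨fun hji => not_lt.mp fun hik => hb ⟨hji, hik⟩, hpred⟩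
    have hnr : ¬ ∃ s, IsRC (insert i I) j s ∧ IsRC (insert i I) k s := fun hs =>
      hn (Or.inl ⟨hj', hk', hs, hjk, hpred'⟩)
    have hir : i.2 < r.2 := by
      by_contra hle
      rw [not_lt] at hle
      exact hnr ⟨r, hjr.insert_of_imp_le fun _ _ => hle, hkr.insert_of_imp_le fun _ _ => hle⟩
    have hki : ¬ k.2 < i.1 := fun hki => hnr ⟨i,
      hjr.insert_self (by linarith) (Or.inl (hjk.trans hki)) hir.le,
      hkr.insert_self (by linarith) (Or.inl hki) hir.le⟩
    have hkr' : IsRC (insert i I) k r := hkr.insert_of_imp_le fun hlt hc =>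
      absurd (hc.resolve_right fun h => by linarith) hki
    have hji : j.2 < i.1 := by
      by_contra hji
      exact hnr ⟨r, hjr.insert_of_imp_le fun hlt hc =>
        absurd (hc.resolve_right fun h => by linarith) hji, hkr'⟩
    refine Or.inr ⟨hj', hjr.insert_self (hji.trans hi) (Or.inl hji) hir.le, ?_⟩
    intro m hm hmi
    by_contra hlt
    exact hki ((hpred' m hm (not_le.mp hlt)).trans_lt (hmi.finish_lt_start hval (hval m hm)))

theorem EC.lTEdge_insert {I : Finset (ℝ × ℝ)} {i j k : ℝ × ℝ}
    (hval : ∀ x ∈ insert i I, x.1 < x.2) (hmono : Monotonic (insert i I))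
    (h : EC I j k) (hn : ¬ LTEdge (insert i I) j k) : LTEdge (insert i I) j i := by
  obtain ⟨hj, hjk, hmax⟩ := h
  have hI : ∀ x ∈ I, x.1 < x.2 := fun x hx => hval x (Finset.mem_insert_of_mem hx)
  have hi := hval i (Finset.mem_insert_self i I)
  have hjv := hI j hj
  have hj' := Finset.mem_insert_of_mem (b := i) hj
  have hk' := Finset.mem_insert_of_mem (b := i) hjk.1
  have hi' := Finset.mem_insert_self i I
  by_cases hc : j.2 < i.1 ∧ i.2 < k.2
  · have hik := hmono.start_lt_start hi' hk' hc.2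
    refine Or.inr ⟨hj', hjk.insert_self (hc.1.trans hi) (Or.inl hc.1) hc.2.le, ?_⟩
    rw [Finset.forall_mem_insert]
    refine ⟨fun h => absurd h.2.1 (lt_irrefl _), fun m hm hmi => ?_⟩
    by_contra hlt
    have hmk := (hmi.finish_lt_start hval (hI m hm)).trans hik
    exact hlt (hmax m hm (hjk.of_le hI hjv (hI m hm) (not_le.mp hlt).le hmk))
  · have hjk' : IsRC (insert i I) j k := hjk.insert_of_imp_le fun hlt hcomp =>
      not_lt.mp fun hik => hc ⟨hcomp.resolve_right fun h => by linarith, hik⟩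
    have hik : IsRC (insert i I) i k ∧ j.2 < i.2 := by
      by_contra hcon
      refine hn (Or.inr ⟨hj', hjk', ?_⟩)
      rw [Finset.forall_mem_insert]
      exact ⟨fun h => not_lt.mp fun hlt => hcon ⟨h, hlt⟩,
        fun m hm hmk => hmax m hm (hmk.of_insert hjk.1)⟩
    refine Or.inl ⟨hj', hi', ⟨k, hjk', hik.1⟩, hik.2, ?_⟩
    rw [Finset.forall_mem_insert]
    refine ⟨fun _ => le_rfl, fun m hm hjm => ?_⟩
    by_contra hlt
    have hmk := (not_le.mp hlt).trans (hik.1.finish_lt_start hval hi)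
    exact absurd (hmax m hm (hjk.of_le hI hjv (hI m hm) hjm.le hmk)) (not_le.mpr hjm)

/-- Any edge of the linearised tree destroyed by inserting a new interval `i`
into a monotonic set `I` is replaced by an edge from its tail to `i`: if
`(j,k)` is an edge of `L(I)` but not of `L(I ∪ {i})`, then `(j,i)` is an edge
of `L(I ∪ {i})`. -/
theorem linearised_tree_insert_destroyed_edges (I : Finset (ℝ × ℝ)) (i : ℝ × ℝ)
    (hval : ∀ x ∈ insert i I, x.1 < x.2)
    (hdist : ∀ x ∈ insert i I, ∀ y ∈ insert i I, x.2 = y.2 → x = y)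
    (hmono : Monotonic I) (hmono' : Monotonic (insert i I))
    (hi : i ∉ I) :
    ∀ j ∈ I, ∀ k ∈ I,
      LTEdge I j k → ¬ LTEdge (insert i I) j k → LTEdge (insert i I) j i := by
  rintro j - k - (h | h) hn
  · exact h.lTEdge_insert hval hmono' hn
  · exact h.lTEdge_insert hval hmono' hn
end

section
/- Let I be a finite set of intervals with pairwise distinct finishing times and let L(I) = (I; E_∼, E_c) be its linearised tree. Then every node of L(I) has at most one outgoing edge, at most one incoming edge from E_∼ (its equivalent child), and at most one incoming edge from E_c (its compatible child); in particular the linearised tree is a binary forest. -/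
theorem IsRC.unique {I : Finset (ℝ × ℝ)} (hdist : ∀ i ∈ I, ∀ j ∈ I, i.2 = j.2 → i = j)
    {i j k : ℝ × ℝ} (hj : IsRC I i j) (hk : IsRC I i k) : j = k :=
  hdist j hj.1 k hk.1 <| le_antisymm (hj.2.2.2 k hk.1 hk.2.1 hk.2.2.1)
    (hk.2.2.2 j hj.1 hj.2.1 hj.2.2.1)

/-- A node with an outgoing equivalence edge is not greatest in its class, so it has no
outgoing compatibility edge. -/
theorem ESim.not_EC {I : Finset (ℝ × ℝ)} (hdist : ∀ i ∈ I, ∀ j ∈ I, i.2 = j.2 → i = j)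
    {i j k : ℝ × ℝ} (hj : ESim I i j) : ¬ EC I i k := by
  rintro ⟨-, hik, hmax⟩
  obtain ⟨-, hjI, ⟨r, hir, hjr⟩, hlt, -⟩ := hj
  obtain rfl := hir.unique hdist hik
  exact (hmax j hjI hjr).not_gt hlt

/-- In the linearised tree of a finite set of intervals with pairwise distinct
finishing times, every node has at most one outgoing edge, at most one incoming
equivalence edge (its equivalent child), and at most one incoming compatibility
edge (its compatible child); in particular the linearised tree is a binary
forest. -/
theorem linearised_tree_binary (I : Finset (ℝ × ℝ))
    (hval : ∀ i ∈ I, i.1 < i.2)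
    (hdist : ∀ i ∈ I, ∀ j ∈ I, i.2 = j.2 → i = j) :
    (∀ i j k : ℝ × ℝ, LTEdge I i j → LTEdge I i k → j = k) ∧
    (∀ i j k : ℝ × ℝ, ESim I j i → ESim I k i → j = k) ∧
    (∀ i j k : ℝ × ℝ, EC I j i → EC I k i → j = k) := by
  refine ⟨?_, ?_, ?_⟩
  · rintro i j k (hj | hj) (hk | hk)
    · obtain ⟨-, hjI, -, hij, hj_min⟩ := hj
      obtain ⟨-, hkI, -, hik, hk_min⟩ := hk
      exact hdist j hjI k hkI (le_antisymm (hj_min k hkI hik) (hk_min j hjI hij))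
    · exact (hj.not_EC hdist hk).elim
    · exact (hk.not_EC hdist hj).elim
    · exact hj.2.1.unique hdist hk.2.1
  · rintro i j k ⟨hjI, -, -, hji, hj_pred⟩ ⟨hkI, -, -, hki, hk_pred⟩
    refine hdist j hjI k hkI (le_antisymm ?_ ?_)
    · exact not_lt.mp fun h => (hk_pred j hjI h).not_gt hji
    · exact not_lt.mp fun h => (hj_pred k hkI h).not_gt hki
  · rintro i j k ⟨hjI, hj_rc, hj_max⟩ ⟨hkI, hk_rc, hk_max⟩
    exact hdist j hjI k hkI (le_antisymm (hk_max j hjI hj_rc) (hj_max k hkI hk_rc))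
end
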